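/- Let p ∈ ℝ and let f : ℝ² × ℝ → ℝ be smooth with compact support contained in ℝ² × (0,∞). Then for every k ∈ ℝ² with k ≠ 0 and every θ ∈ (0, π/2), the three-dimensional Fourier slice identity holds (with the Bessel function J_0 expressed by its integral representation): tan(θ) · ∫_0^∞ y^{1−p} · (F f)(k, y) · (∫_0^{2π} e^{i·y·tan(θ)·|k|·cos(φ)} dφ) dy = cos(θ)^{1−p} · (F R^(p) f)(k, θ). -/

import Mathlib

open MeasureTheory Real Metric
open scoped RealInnerProductSpace

noncomputable section

/-- The arclength measure on the unit circle `S^1 ⊆ ℝ²`. -/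
def circleMeasure : Measure (sphere (0 : EuclideanSpace ℝ (Fin 2)) 1) :=
  (volume : Measure (EuclideanSpace ℝ (Fin 2))).toSphere

/-- The three-dimensional conical Radon transform with radial weight `1/s^p`:
`(R^(p) f)(u, θ) = ∫_0^∞ s^(-p) ∫_{S^1} f(u + s sin θ n, s cos θ) (s sin θ) dn ds`. -/
def coneRadon3 (p : ℝ) (f : EuclideanSpace ℝ (Fin 2) × ℝ → ℝ)
    (u : EuclideanSpace ℝ (Fin 2)) (θ : ℝ) : ℝ :=
  ∫ s in Set.Ioi (0 : ℝ),
    s ^ (-p) *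
      ∫ n, f (u + (s * Real.sin θ) • (n : EuclideanSpace ℝ (Fin 2)), s * Real.cos θ) *
          (s * Real.sin θ) ∂circleMeasure

/-- The Laplacian of a function on `ℝ²`, as the sum of the second partial derivatives. -/
def lap2 (h : EuclideanSpace ℝ (Fin 2) → ℝ) (u : EuclideanSpace ℝ (Fin 2)) : ℝ :=
  ∑ i : Fin 2,
    fderiv ℝ (fun v => fderiv ℝ h v (EuclideanSpace.single i (1 : ℝ))) u
      (EuclideanSpace.single i (1 : ℝ))

/-- Fourier transform in the first (two-dimensional) argument:
`(F g)(k, y) = ∫_{ℝ²} e^{-i⟨k,u⟩} g(u, y) du`. -/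
def fourierFirst3 (g : EuclideanSpace ℝ (Fin 2) → ℝ → ℝ)
    (k : EuclideanSpace ℝ (Fin 2)) (y : ℝ) : ℂ :=
  ∫ u, Complex.exp (-Complex.I * (⟪k, u⟫ : ℝ)) * (g u y : ℂ)

open Set Module in
theorem integral_radial_mul_angular {E : Type*} [NormedAddCommGroup E] [NormedSpace ℝ E]
    [MeasurableSpace E] [BorelSpace E] [FiniteDimensional ℝ E] [Nontrivial E]
    (μ : Measure E) [μ.IsAddHaarMeasure] (w : ℝ → ℂ) (h : E → ℂ) :
    ∫ x, h (‖x‖⁻¹ • x) * w ‖x‖ ∂μ =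
      (∫ n, h n ∂μ.toSphere) * ∫ r in Ioi (0 : ℝ), ((r ^ (finrank ℝ E - 1) : ℝ) : ℂ) * w r := by
  calc
    _ = ∫ x : ({(0)}ᶜ : Set E), h (‖x.1‖⁻¹ • x.1) * w ‖x.1‖ ∂(μ.comap (↑)) := by
      rw [integral_subtype_comap (measurableSet_singleton _).compl
        fun x ↦ h (‖x‖⁻¹ • x) * w ‖x‖, restrict_compl_singleton]
    _ = ∫ x : sphere (0 : E) 1 × Ioi (0 : ℝ), h x.1 * w x.2
          ∂μ.toSphere.prod (.volumeIoiPow (finrank ℝ E - 1)) := by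
      simpa using μ.measurePreserving_homeomorphUnitSphereProd.integral_comp
        (Homeomorph.measurableEmbedding _)
        (fun x : sphere (0 : E) 1 × Ioi (0 : ℝ) ↦ h x.1 * w x.2)
    _ = (∫ n, h n ∂μ.toSphere) * ∫ r : Ioi (0 : ℝ), w r ∂.volumeIoiPow (finrank ℝ E - 1) :=
      integral_prod_mul (fun n : sphere (0 : E) 1 ↦ h n) (fun r : Ioi (0 : ℝ) ↦ w r)
    _ = _ := by
      simp only [Measure.volumeIoiPow, ENNReal.ofReal]
      rw [integral_withDensity_eq_integral_smul,
        integral_subtype_comap measurableSet_Ioi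
          fun a ↦ Real.toNNReal (a ^ (finrank ℝ E - 1)) • w a,
        setIntegral_congr_fun measurableSet_Ioi fun x hx ↦ ?_]
      · rw [NNReal.smul_def, Real.coe_toNNReal _ (pow_nonneg hx.out.le _), Complex.real_smul]
      · exact (measurable_subtype_coe.pow_const _).real_toNNReal

theorem integral_Ioi_mul_exp_neg :
    ∫ r in Set.Ioi (0 : ℝ), ((r : ℝ) : ℂ) * ((Real.exp (-r) : ℝ) : ℂ) = 1 := by
  have h := Real.Gamma_eq_integral (s := 2) two_pos
  rw [Real.Gamma_two] at h
  simp_rw [← Complex.ofReal_mul]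
  rw [integral_complex_ofReal, ← Complex.ofReal_one, h]
  congr 1
  refine setIntegral_congr_fun measurableSet_Ioi fun r _ ↦ ?_
  norm_num [mul_comm]

theorem exists_complex_isometry_map_one {e : EuclideanSpace ℝ (Fin 2)} (he : ‖e‖ = 1) :
    ∃ Φ : ℂ ≃ₗᵢ[ℝ] EuclideanSpace ℝ (Fin 2), ∀ z : ℂ, ⟪e, Φ z⟫ = z.re := by
  have hv : Orthonormal ℝ (({0} : Set (Fin 2)).domRestrict fun _ ↦ e) :=
    ⟨fun _ ↦ he, fun i j hij ↦ absurd (Subsingleton.elim i j) hij⟩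
  obtain ⟨b, hb⟩ := hv.exists_orthonormalBasis_extension_of_card_eq (by simp)
  refine ⟨Complex.isometryOfOrthonormal b, fun z ↦ ?_⟩
  rw [Complex.isometryOfOrthonormal_apply, ← hb 0 rfl, inner_add_right, inner_smul_right,
    inner_smul_right, b.inner_eq_one, b.inner_eq_zero (by decide)]
  simp

theorem integral_circleMeasure_inner {k : EuclideanSpace ℝ (Fin 2)} (hk : k ≠ 0) (g : ℝ → ℂ) :
    ∫ n, g ⟪k, (n : EuclideanSpace ℝ (Fin 2))⟫ ∂circleMeasure =
      ∫ φ in (0 : ℝ)..(2 * π), g (‖k‖ * Real.cos φ) := by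
  have hk' : ‖k‖ ≠ 0 := norm_ne_zero_iff.2 hk
  obtain ⟨Φ, hΦ⟩ := exists_complex_isometry_map_one (norm_smul_inv_norm (𝕜 := ℝ) hk)
  have hkΦ (z : ℂ) : ⟪k, Φ z⟫ = ‖k‖ * z.re := by
    rw [← hΦ z, real_inner_smul_left]
    simp [hk']
  have hE := integral_radial_mul_angular (volume : Measure (EuclideanSpace ℝ (Fin 2)))
    (fun r ↦ ((Real.exp (-r) : ℝ) : ℂ)) (fun x ↦ g ⟪k, x⟫)
  simp only [finrank_euclideanSpace, Fintype.card_fin, Nat.add_one_sub_one, pow_one,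
    integral_Ioi_mul_exp_neg, mul_one] at hE
  rw [circleMeasure, ← hE, ← Φ.measurePreserving.integral_comp
    Φ.toHomeomorph.measurableEmbedding, ← Complex.integral_comp_polarCoord_symm]
  have hshift : ∫ φ in (0 : ℝ)..(2 * π), g (‖k‖ * Real.cos φ) =
      ∫ φ in Set.Ioo (-π) π, g (‖k‖ * Real.cos φ) := by
    have hp : Function.Periodic (fun φ ↦ g (‖k‖ * Real.cos φ)) (2 * π) := fun φ ↦ by simp
    have h := hp.intervalIntegral_add_eq 0 (-π)
    rw [zero_add, show -π + 2 * π = π by ring] at h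
    rw [h, intervalIntegral.integral_of_le (by linarith [pi_pos]), integral_Ioc_eq_integral_Ioo]
  rw [hshift, ← one_mul (∫ φ in Set.Ioo (-π) π, _), ← integral_Ioi_mul_exp_neg,
    ← setIntegral_prod_mul]
  refine setIntegral_congr_fun (measurableSet_Ioi.prod measurableSet_Ioo) fun q hq ↦ ?_
  have hq1 : 0 < q.1 := hq.1
  have hn : ‖Complex.polarCoord.symm q‖ = q.1 := by
    rw [Complex.norm_polarCoord_symm, abs_of_pos hq1]
  have hre : (Complex.polarCoord.symm q).re = q.1 * Real.cos q.2 := by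
    simp [Complex.polarCoord_symm_apply, Complex.cos_ofReal_re]
  simp only [LinearIsometryEquiv.norm_map, hn, real_inner_smul_right, hkΦ, hre,
    Complex.real_smul]
  rw [show q.1⁻¹ * (‖k‖ * (q.1 * Real.cos q.2)) = ‖k‖ * Real.cos q.2 by field_simp]
  ring

theorem fourier_cone_integral {W : EuclideanSpace ℝ (Fin 2) × ℝ → ℝ} (hW : Continuous W)
    (hWc : HasCompactSupport W) (k : EuclideanSpace ℝ (Fin 2)) (a : ℝ) {c : ℝ} (hc : c ≠ 0) :
    ∫ u, Complex.exp (-Complex.I * (⟪k, u⟫ : ℝ)) *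
        ((∫ s in Set.Ioi (0 : ℝ), ∫ n, W (u + (s * a) • (n : EuclideanSpace ℝ (Fin 2)), s * c)
          ∂circleMeasure : ℝ) : ℂ) =
      ∫ s in Set.Ioi (0 : ℝ), fourierFirst3 (fun u y ↦ W (u, y)) k (s * c) *
        ∫ n, Complex.exp (Complex.I * (s * a * ⟪k, (n : EuclideanSpace ℝ (Fin 2))⟫ : ℝ))
          ∂circleMeasure := by
  have : IsFiniteMeasure circleMeasure := by unfold circleMeasure; infer_instance
  let T : EuclideanSpace ℝ (Fin 2) × ℝ × sphere (0 : EuclideanSpace ℝ (Fin 2)) 1 →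
      EuclideanSpace ℝ (Fin 2) × ℝ :=
    fun q ↦ (q.1 + (q.2.1 * a) • (q.2.2 : EuclideanSpace ℝ (Fin 2)), q.2.1 * c)
  have hT : Continuous T := by fun_prop
  have hTc : HasCompactSupport (W ∘ T) := by
    obtain ⟨R, hR⟩ := hWc.isCompact.isBounded.exists_norm_le
    refine HasCompactSupport.intro
      ((isCompact_closedBall (0 : EuclideanSpace ℝ (Fin 2)) (R + R / |c| * |a|)).prod
        ((isCompact_closedBall (0 : ℝ) (R / |c|)).prod isCompact_univ)) fun q hq ↦ ?_
    by_contra h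
    have hq' := hR _ (subset_tsupport W (show T q ∈ Function.support W from h))
    have h1 : ‖q.1 + (q.2.1 * a) • (q.2.2 : EuclideanSpace ℝ (Fin 2))‖ ≤ R :=
      (norm_fst_le (T q)).trans hq'
    have h2 : |q.2.1| ≤ R / |c| := by
      rw [le_div_iff₀ (abs_pos.2 hc), ← abs_mul]
      exact (norm_snd_le (T q)).trans hq'
    refine hq ⟨?_, by simpa using h2, Set.mem_univ _⟩
    rw [mem_closedBall_zero_iff]
    have h3 : ‖(q.2.1 * a) • (q.2.2 : EuclideanSpace ℝ (Fin 2))‖ ≤ R / |c| * |a| := by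
      rw [norm_smul, norm_eq_of_mem_sphere, mul_one, Real.norm_eq_abs, abs_mul]
      gcongr
    have h4 := norm_sub_le (q.1 + (q.2.1 * a) • (q.2.2 : EuclideanSpace ℝ (Fin 2)))
      ((q.2.1 * a) • (q.2.2 : EuclideanSpace ℝ (Fin 2)))
    rw [add_sub_cancel_right] at h4
    linarith
  let μ := (volume.restrict (Set.Ioi (0 : ℝ))).prod circleMeasure
  let H : EuclideanSpace ℝ (Fin 2) → ℝ × sphere (0 : EuclideanSpace ℝ (Fin 2)) 1 → ℂ :=
    fun u q ↦ Complex.exp (-Complex.I * (⟪k, u⟫ : ℝ)) * (W (T (u, q)) : ℂ)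
  have hWT : Continuous (W ∘ T) := hW.comp hT
  have hH : Integrable (Function.uncurry H) (volume.prod μ) := by
    have hcont : Continuous (Function.uncurry H) := by
      refine Continuous.mul (by fun_prop) (Complex.continuous_ofReal.comp hWT)
    refine hcont.integrable_of_hasCompactSupport ?_
    exact (hTc.comp_left (g := ((↑) : ℝ → ℂ)) Complex.ofReal_zero).mul_left
  have hslice (u : EuclideanSpace ℝ (Fin 2)) :
      Integrable (fun q ↦ W (T (u, q))) μ := by
    refine (hWT.comp (Continuous.prodMk_right u)).integrable_of_hasCompactSupport ?_
    exact hTc.comp_isClosedEmbedding (Function.LeftInverse.isClosedEmbedding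
      (f := Prod.snd) (g := Prod.mk u) (fun _ ↦ rfl) continuous_snd (Continuous.prodMk_right u))
  have hshift (q : ℝ × sphere (0 : EuclideanSpace ℝ (Fin 2)) 1) :
      ∫ u, H u q = fourierFirst3 (fun u y ↦ W (u, y)) k (q.1 * c) *
        Complex.exp (Complex.I *
          (q.1 * a * ⟪k, (q.2 : EuclideanSpace ℝ (Fin 2))⟫ : ℝ)) := by
    symm
    rw [fourierFirst3, ← integral_mul_const, ← integral_add_right_eq_self _
      ((q.1 * a) • (q.2 : EuclideanSpace ℝ (Fin 2)))]
    refine integral_congr_ae (.of_forall fun u ↦ ?_)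
    simp only [H, T]
    rw [mul_right_comm, ← Complex.exp_add, inner_add_right, real_inner_smul_right]
    congr 2
    push_cast
    ring
  calc
    _ = ∫ u, ∫ q, H u q ∂μ := by
      refine integral_congr_ae (.of_forall fun u ↦ ?_)
      simp only [H]
      rw [integral_const_mul, integral_complex_ofReal, integral_prod _ (hslice u)]
    _ = ∫ q, (∫ u, H u q) ∂μ := integral_integral_swap hH
    _ = _ := by
      rw [integral_prod (fun q ↦ ∫ u, H u q) hH.integral_prod_right]
      simp_rw [hshift, integral_const_mul]

/-- three-dimensional Fourier slice identity, with `2π J₀` written as an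
integral: `tan θ ∫_0^∞ y^{1-p} (F f)(k, y) (∫_0^{2π} e^{i y tan θ |k| cos φ} dφ) dy
= cos θ^{1-p} (F R^(p) f)(k, θ)`. -/
theorem coneRadon3_fourier_slice (p : ℝ) (f : EuclideanSpace ℝ (Fin 2) × ℝ → ℝ)
    (hf : ContDiff ℝ (⊤ : ℕ∞) f) (hfc : HasCompactSupport f)
    (hfs : tsupport f ⊆ {q : EuclideanSpace ℝ (Fin 2) × ℝ | 0 < q.2})
    (k : EuclideanSpace ℝ (Fin 2)) (hk : k ≠ 0) (θ : ℝ) (hθ : θ ∈ Set.Ioo (0 : ℝ) (π / 2)) :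
    ((Real.tan θ : ℝ) : ℂ) *
        ∫ y in Set.Ioi (0 : ℝ),
          ((y ^ (1 - p) : ℝ) : ℂ) * fourierFirst3 (fun u y => f (u, y)) k y *
            ∫ φ in (0 : ℝ)..(2 * π),
              Complex.exp (Complex.I * (y * Real.tan θ * ‖k‖ * Real.cos φ : ℝ)) =
      ((Real.cos θ ^ (1 - p) : ℝ) : ℂ) * fourierFirst3 (coneRadon3 p f) k θ := by
  obtain ⟨hθ0, hθ1⟩ := hθ
  have hc : 0 < Real.cos θ := Real.cos_pos_of_mem_Ioo ⟨by linarith, hθ1⟩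
  let W : EuclideanSpace ℝ (Fin 2) × ℝ → ℝ := fun q ↦ q.2 ^ (1 - p) * f q
  have hWc : HasCompactSupport W := hfc.mul_left
  have hW : Continuous W := continuous_of_tsupport fun q hq ↦ by
    have hq0 : 0 < q.2 := hfs (tsupport_mul_subset_right hq)
    exact (continuousAt_snd.rpow_const (.inl hq0.ne')).mul hf.continuous.continuousAt
  have hcone (u : EuclideanSpace ℝ (Fin 2)) : coneRadon3 p f u θ =
      Real.cos θ ^ (p - 1) * Real.sin θ * ∫ s in Set.Ioi (0 : ℝ), ∫ n,
        W (u + (s * Real.sin θ) • (n : EuclideanSpace ℝ (Fin 2)), s * Real.cos θ)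
          ∂circleMeasure := by
    rw [coneRadon3, ← integral_const_mul]
    refine setIntegral_congr_fun measurableSet_Ioi fun s hs ↦ ?_
    have hs0 : 0 < s := hs
    have hpow : s ^ (-p) * s = Real.cos θ ^ (p - 1) * (s * Real.cos θ) ^ (1 - p) := by
      rw [Real.mul_rpow hs0.le hc.le, mul_left_comm, ← Real.rpow_add hc,
        ← Real.rpow_add_one hs0.ne', show p - 1 + (1 - p) = 0 by ring, Real.rpow_zero, mul_one,
        neg_add_eq_sub]
    simp only [W]
    rw [integral_const_mul, integral_mul_const]
    linear_combination (Real.sin θ * ∫ n, f (u + (s * Real.sin θ) •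
      (n : EuclideanSpace ℝ (Fin 2)), s * Real.cos θ) ∂circleMeasure) * hpow
  have hFW (y : ℝ) : fourierFirst3 (fun u y ↦ W (u, y)) k y =
      ((y ^ (1 - p) : ℝ) : ℂ) * fourierFirst3 (fun u y ↦ f (u, y)) k y := by
    simp only [fourierFirst3, W, ← integral_const_mul]
    refine integral_congr_ae (.of_forall fun u ↦ ?_)
    push_cast
    ring
  have hF : fourierFirst3 (coneRadon3 p f) k θ =
      ((Real.cos θ ^ (p - 1) * Real.sin θ : ℝ) : ℂ) * ∫ s in Set.Ioi (0 : ℝ),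
        fourierFirst3 (fun u y ↦ W (u, y)) k (s * Real.cos θ) *
        ∫ n, Complex.exp (Complex.I *
          (s * Real.sin θ * ⟪k, (n : EuclideanSpace ℝ (Fin 2))⟫ : ℝ)) ∂circleMeasure := by
    rw [← fourier_cone_integral hW hWc k _ hc.ne', ← integral_const_mul, fourierFirst3]
    refine integral_congr_ae (.of_forall fun u ↦ ?_)
    simp only [hcone]
    push_cast
    ring
  have hsub := integral_comp_mul_right_Ioi (fun y : ℝ ↦
    fourierFirst3 (fun u y ↦ W (u, y)) k y * ∫ φ in (0 : ℝ)..(2 * π),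
      Complex.exp (Complex.I * (y * Real.tan θ * ‖k‖ * Real.cos φ : ℝ))) 0 hc
  rw [zero_mul] at hsub
  have hcirc (s : ℝ) : ∫ n, Complex.exp (Complex.I *
        (s * Real.sin θ * ⟪k, (n : EuclideanSpace ℝ (Fin 2))⟫ : ℝ)) ∂circleMeasure =
      ∫ φ in (0 : ℝ)..(2 * π), Complex.exp (Complex.I *
        (s * Real.cos θ * Real.tan θ * ‖k‖ * Real.cos φ : ℝ)) := by
    rw [integral_circleMeasure_inner hk
      fun t ↦ Complex.exp (Complex.I * (s * Real.sin θ * t : ℝ))]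
    simp_rw [mul_assoc s, mul_comm (Real.cos θ) (Real.tan θ), Real.tan_mul_cos hc.ne', mul_assoc]
  simp_rw [hF, hcirc, hsub, ← hFW]
  rw [Complex.real_smul, ← mul_assoc, ← mul_assoc, ← Complex.ofReal_mul, ← Complex.ofReal_mul]
  congr 2
  have hcc : Real.cos θ ^ (1 - p) * Real.cos θ ^ (p - 1) = 1 := by
    rw [← Real.rpow_add hc]
    simp
  rw [← mul_assoc, hcc, one_mul, Real.tan_eq_sin_div_cos, div_eq_mul_inv]
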